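/- arXiv:1909.01264 — 4 statements merged into one kernel-verified Lean document; each statement's English description precedes it below -/
import Mathlib

section
/- Let X ∈ ℝ^{n×d} be a matrix with entries X_{ij} ∈ [−1/√d, 1/√d] and smallest singular value σ_min = a·√(n/d) for some a ∈ (0,1]. Let X̃ be a b-bit unbiased stochastic uniform quantization of X (entrywise, over the range [−1/√d, 1/√d]). Then for n ≥ max(33, d), the expected eigenspace overlap score over the randomness of the quantization satisfies E[1 − E(X, X̃)] ≤ 20 / ((2^b − 1)² · a⁴). -/
open MeasureTheory Matrix ProbabilityTheory

noncomputable section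

/-- Squared Euclidean norm of a vector. -/
def normSq {n : ℕ} (v : Fin n → ℝ) : ℝ := ∑ i, (v i) ^ 2

/-- Squared Frobenius norm of a matrix. -/
def frobSq {m k : ℕ} (A : Matrix (Fin m) (Fin k) ℝ) : ℝ := ∑ i, ∑ j, (A i j) ^ 2

theorem frobSq_eq_trace {m k : ℕ} (A : Matrix (Fin m) (Fin k) ℝ) :
    frobSq A = (Aᵀ * A).trace := by
  simp only [frobSq, Matrix.trace, Matrix.diag_apply, Matrix.mul_apply, Matrix.transpose_apply]
  rw [Finset.sum_comm]
  simp only [sq]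

theorem frobSq_nonneg {m k : ℕ} (A : Matrix (Fin m) (Fin k) ℝ) : 0 ≤ frobSq A :=
  Finset.sum_nonneg fun _ _ => Finset.sum_nonneg fun _ _ => sq_nonneg _

theorem frobSq_transpose {m k : ℕ} (A : Matrix (Fin m) (Fin k) ℝ) : frobSq Aᵀ = frobSq A :=
  Finset.sum_comm

theorem normSq_nonneg {n : ℕ} (v : Fin n → ℝ) : 0 ≤ normSq v :=
  Finset.sum_nonneg fun _ _ => sq_nonneg _

theorem normSq_eq_dotProduct {n : ℕ} (v : Fin n → ℝ) : normSq v = v ⬝ᵥ v := by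
  simp only [normSq, dotProduct, sq]

theorem normSq_smul {n : ℕ} (c : ℝ) (v : Fin n → ℝ) : normSq (c • v) = c ^ 2 * normSq v := by
  simp only [normSq, Pi.smul_apply, smul_eq_mul, mul_pow, Finset.mul_sum]

theorem eq_zero_of_normSq_eq_zero {n : ℕ} {v : Fin n → ℝ} (h : normSq v = 0) : v = 0 := by
  rw [normSq_eq_dotProduct] at h
  exact dotProduct_self_eq_zero.mp h

/-- Pythagoras for the orthogonal projection onto the column space of `V`. -/
theorem frobSq_compl_proj_mul {n d m : ℕ} {V : Matrix (Fin n) (Fin d) ℝ} (hV : Vᵀ * V = 1)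
    (Y : Matrix (Fin n) (Fin m) ℝ) :
    frobSq ((1 - V * Vᵀ) * Y) = frobSq Y - frobSq (Vᵀ * Y) := by
  have hproj : (1 - V * Vᵀ)ᵀ * (1 - V * Vᵀ) = 1 - V * Vᵀ := by
    have hidem : V * Vᵀ * (V * Vᵀ) = V * Vᵀ := by
      rw [Matrix.mul_assoc, ← Matrix.mul_assoc Vᵀ, hV, Matrix.one_mul]
    simp only [Matrix.transpose_sub, Matrix.transpose_one, Matrix.transpose_mul,
      Matrix.transpose_transpose, Matrix.sub_mul, Matrix.mul_sub, Matrix.one_mul, Matrix.mul_one,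
      hidem, sub_self, sub_zero]
  have key : ((1 - V * Vᵀ) * Y)ᵀ * ((1 - V * Vᵀ) * Y) = Yᵀ * Y - (Vᵀ * Y)ᵀ * (Vᵀ * Y) := by
    rw [Matrix.transpose_mul, Matrix.mul_assoc, ← Matrix.mul_assoc _ _ Y, hproj]
    simp only [Matrix.transpose_mul, Matrix.transpose_transpose, Matrix.sub_mul, Matrix.mul_sub,
      Matrix.one_mul, Matrix.mul_assoc]
  rw [frobSq_eq_trace, key, Matrix.trace_sub, ← frobSq_eq_trace, ← frobSq_eq_trace]

/-- A lower bound for a quadratic form on the unit sphere extends to all vectors. -/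
theorem mul_normSq_le_of_unit {n d : ℕ} {X : Matrix (Fin n) (Fin d) ℝ} {s : ℝ}
    (h : ∀ w : Fin d → ℝ, normSq w = 1 → s ≤ normSq (X *ᵥ w)) (w : Fin d → ℝ) :
    s * normSq w ≤ normSq (X *ᵥ w) := by
  rcases (normSq_nonneg w).eq_or_lt with h0 | hpos
  · rw [← h0, mul_zero]
    exact normSq_nonneg _
  · have hc : (Real.sqrt (normSq w))⁻¹ ^ 2 = (normSq w)⁻¹ := by
      rw [inv_pow, Real.sq_sqrt hpos.le]
    have := h ((Real.sqrt (normSq w))⁻¹ • w) (by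
      rw [normSq_smul, hc, inv_mul_cancel₀ hpos.ne'])
    rw [Matrix.mulVec_smul, normSq_smul, hc, inv_mul_eq_div, le_div_iff₀ hpos] at this
    exact this

/-- A square matrix and its transpose have the same smallest singular value. -/
theorem mul_normSq_le_transpose {d : ℕ} {M : Matrix (Fin d) (Fin d) ℝ} {s : ℝ} (hs : 0 < s)
    (h : ∀ w, s * normSq w ≤ normSq (M *ᵥ w)) (u : Fin d → ℝ) :
    s * normSq u ≤ normSq (Mᵀ *ᵥ u) := by
  have hinj : Function.Injective M.mulVecLin := by
    rw [← LinearMap.ker_eq_bot, LinearMap.ker_eq_bot']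
    intro w hw
    have hw' : M *ᵥ w = 0 := hw
    have hle := h w
    rw [hw'] at hle
    have h0 : normSq (0 : Fin d → ℝ) = 0 := by simp [normSq]
    rw [h0] at hle
    exact eq_zero_of_normSq_eq_zero
      (le_antisymm (nonpos_of_mul_nonpos_right hle hs) (normSq_nonneg w))
  obtain ⟨w, hw⟩ := LinearMap.injective_iff_surjective.mp hinj u
  have hw' : M *ᵥ w = u := hw
  have hdot : normSq u = (Mᵀ *ᵥ u) ⬝ᵥ w := by
    rw [Matrix.mulVec_transpose, ← Matrix.dotProduct_mulVec, hw', normSq_eq_dotProduct]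
  have hcs : normSq u ^ 2 ≤ normSq (Mᵀ *ᵥ u) * normSq w := by
    rw [hdot]
    exact Finset.sum_mul_sq_le_sq_mul_sq _ _ _
  have hwu : s * normSq w ≤ normSq u := hw' ▸ h w
  rcases (normSq_nonneg u).eq_or_lt with h0 | hpos
  · rw [← h0, mul_zero]
    exact normSq_nonneg _
  · refine le_of_mul_le_mul_right ?_ hpos
    calc s * normSq u * normSq u = s * normSq u ^ 2 := by ring
      _ ≤ s * (normSq (Mᵀ *ᵥ u) * normSq w) := by gcongr
      _ = normSq (Mᵀ *ᵥ u) * (s * normSq w) := by ring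
      _ ≤ normSq (Mᵀ *ᵥ u) * normSq u := mul_le_mul_of_nonneg_left hwu (normSq_nonneg _)

theorem mul_frobSq_le_frobSq_mul {m d : ℕ} {M : Matrix (Fin d) (Fin d) ℝ} {s : ℝ} (hs : 0 < s)
    (h : ∀ w, s * normSq w ≤ normSq (M *ᵥ w)) (A : Matrix (Fin m) (Fin d) ℝ) :
    s * frobSq A ≤ frobSq (A * M) := by
  rw [frobSq, frobSq, Finset.mul_sum]
  refine Finset.sum_le_sum fun i _ => ?_
  have hrow := mul_normSq_le_transpose hs h (A i)
  rw [Matrix.mulVec_transpose] at hrow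
  exact hrow

/-- A sine-theta bound: the subspace distance between the column space of `X` and a subspace
containing the columns of `Y` is controlled by `‖X - Y‖_F` and the smallest singular value. -/
theorem mul_card_sub_overlap_le {n d : ℕ} {X Y U V : Matrix (Fin n) (Fin d) ℝ} {s : ℝ}
    (hs : 0 < s) (hX : ∀ w, s * normSq w ≤ normSq (X *ᵥ w))
    (hU : Uᵀ * U = 1) (hUX : U * Uᵀ * X = X) (hV : Vᵀ * V = 1) (hVY : V * Vᵀ * Y = Y) :
    s * (d - frobSq (Uᵀ * V)) ≤ frobSq (X - Y) := by
  have hM : ∀ w, s * normSq w ≤ normSq ((Uᵀ * X) *ᵥ w) := by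
    intro w
    refine (hX w).trans_eq ?_
    rw [normSq_eq_dotProduct, normSq_eq_dotProduct]
    have hiso : ∀ v, (U *ᵥ v) ⬝ᵥ (U *ᵥ v) = v ⬝ᵥ v := by
      intro v
      rw [Matrix.dotProduct_mulVec, ← Matrix.mulVec_transpose, Matrix.mulVec_mulVec, hU,
        Matrix.one_mulVec]
    rw [← hiso, Matrix.mulVec_mulVec, ← Matrix.mul_assoc, hUX]
  have hUd : frobSq U = d := by
    rw [frobSq_eq_trace, hU, Matrix.trace_one, Fintype.card_fin]
  have hoverlap : frobSq (Uᵀ * V) = frobSq (Vᵀ * U) := by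
    rw [← frobSq_transpose, Matrix.transpose_mul, Matrix.transpose_transpose]
  have hYzero : (1 - V * Vᵀ) * Y = 0 := by
    rw [Matrix.sub_mul, Matrix.one_mul, hVY, sub_self]
  calc s * (d - frobSq (Uᵀ * V)) = s * frobSq ((1 - V * Vᵀ) * U) := by
        rw [frobSq_compl_proj_mul hV, hUd, hoverlap]
    _ ≤ frobSq ((1 - V * Vᵀ) * U * (Uᵀ * X)) := mul_frobSq_le_frobSq_mul hs hM _
    _ = frobSq ((1 - V * Vᵀ) * (X - Y)) := by
        rw [Matrix.mul_assoc, ← Matrix.mul_assoc U, hUX, Matrix.mul_sub, hYzero, sub_zero]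
    _ ≤ frobSq (X - Y) := by
        rw [frobSq_compl_proj_mul hV]
        linarith [frobSq_nonneg (Vᵀ * (X - Y))]

theorem frobSq_le_of_entry_sq_le {m k : ℕ} {A : Matrix (Fin m) (Fin k) ℝ} {c : ℝ}
    (h : ∀ i j, A i j ^ 2 ≤ c) : frobSq A ≤ m * k * c := by
  calc frobSq A ≤ ∑ _i : Fin m, ∑ _j : Fin k, c :=
        Finset.sum_le_sum fun i _ => Finset.sum_le_sum fun j _ => h i j
    _ = m * k * c := by simp [mul_assoc]

/-- Let `X ∈ ℝ^{n×d}` have entries in `[−1/√d, 1/√d]` and smallest singular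
value `σ_min = a √(n/d)` with `a ∈ (0,1]`.  Let `X̃` be a `b`-bit unbiased stochastic uniform
quantization of `X` (entrywise, over the range `[−1/√d, 1/√d]`, with independent entries).
Then for `n ≥ max(33, d)`, `E[1 − E(X, X̃)] ≤ 20/((2^b − 1)² a⁴)`, where the eigenspace
overlap score `E(X, X̃ ω)` is `(1/max(d,d))‖Uᵀ Ũ(ω)‖_F²` for eigenvector matrices `U`, `Ũ(ω)`
of the Gram matrices `XXᵀ` and `X̃(ω)X̃(ω)ᵀ` (orthonormal columns of eigenvectors whose span
contains the respective column spaces). -/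
theorem expected_overlap_of_uniform_quantization
    {n d b : ℕ} {Ω : Type} [MeasurableSpace Ω]
    (μ : Measure Ω) [IsProbabilityMeasure μ]
    (X : Matrix (Fin n) (Fin d) ℝ) (Xt : Ω → Matrix (Fin n) (Fin d) ℝ)
    (U : Matrix (Fin n) (Fin d) ℝ) (Ut : Ω → Matrix (Fin n) (Fin d) ℝ)
    (a : ℝ)
    (hb : 1 ≤ b) (hd : 0 < d) (hn : max 33 d ≤ n)
    (ha : a ∈ Set.Ioc (0 : ℝ) 1)
    -- the entries of X are bounded: X_{ij} ∈ [−1/√d, 1/√d]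
    (hXbdd : ∀ i j, X i j ∈ Set.Icc (-(1 / Real.sqrt d)) (1 / Real.sqrt d))
    -- the smallest singular value of X is a·√(n/d), i.e. min_{‖w‖=1} ‖Xw‖² = a²·n/d
    (hsmin : IsLeast {t : ℝ | ∃ w : Fin d → ℝ, normSq w = 1 ∧ t = normSq (X *ᵥ w)}
      (a ^ 2 * ((n : ℝ) / d)))
    -- X̃ is a b-bit unbiased stochastic uniform quantization of X over [−1/√d, 1/√d]:
    -- each entry is supported on the two endpoints of the grid subinterval of
    -- [−1/√d, 1/√d] (divided into 2^b − 1 equal parts) containing X_{ij}, is unbiased,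
    -- and the entries are independent
    (hXtmeas : ∀ i j, Measurable fun ω => Xt ω i j)
    (hquant : ∀ i j, ∃ m : ℕ, m + 1 ≤ 2 ^ b - 1 ∧
      X i j ∈ Set.Icc
        (-(1 / Real.sqrt d) + m * (2 * (1 / Real.sqrt d) / ((2 : ℝ) ^ b - 1)))
        (-(1 / Real.sqrt d) + (m + 1) * (2 * (1 / Real.sqrt d) / ((2 : ℝ) ^ b - 1))) ∧
      (∀ᵐ ω ∂μ,
        Xt ω i j = -(1 / Real.sqrt d) + m * (2 * (1 / Real.sqrt d) / ((2 : ℝ) ^ b - 1)) ∨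
        Xt ω i j = -(1 / Real.sqrt d) + (m + 1) * (2 * (1 / Real.sqrt d) / ((2 : ℝ) ^ b - 1))) ∧
      ∫ ω, Xt ω i j ∂μ = X i j)
    (hind : iIndepFun
      (fun (p : Fin n × Fin d) ω => Xt ω p.1 p.2) μ)
    -- U is an orthonormal eigenvector matrix of XXᵀ whose columns span the column space of X
    (hU : Uᵀ * U = 1)
    (hUeig : ∃ D : Matrix (Fin d) (Fin d) ℝ,
      (∀ i j, i ≠ j → D i j = 0) ∧ X * Xᵀ * U = U * D)
    (hUspan : U * Uᵀ * X = X)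
    -- Ũ(ω) is an orthonormal eigenvector matrix of X̃(ω)X̃(ω)ᵀ whose columns span a
    -- d-dimensional invariant subspace containing the column space of X̃(ω)
    (hUt : ∀ ω, (Ut ω)ᵀ * Ut ω = 1)
    (hUteig : ∀ ω, ∃ D : Matrix (Fin d) (Fin d) ℝ,
      (∀ i j, i ≠ j → D i j = 0) ∧ Xt ω * (Xt ω)ᵀ * Ut ω = Ut ω * D)
    (hUtspan : ∀ ω, Ut ω * (Ut ω)ᵀ * Xt ω = Xt ω) :
    ∫ ω, (1 - (1 / (max d d : ℝ)) * frobSq (Uᵀ * Ut ω)) ∂μ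
      ≤ 20 / (((2 : ℝ) ^ b - 1) ^ 2 * a ^ 4) := by
  have hn0 : (0 : ℝ) < n := by
    have : 33 ≤ n := (le_max_left _ _).trans hn
    exact_mod_cast (by omega : 0 < n)
  have hd0 : (0 : ℝ) < d := by exact_mod_cast hd
  obtain ⟨ha0, ha1⟩ := ha
  have hq : (0 : ℝ) < (2 : ℝ) ^ b - 1 :=
    sub_pos.mpr (one_lt_pow₀ one_lt_two (by omega))
  set q : ℝ := (2 : ℝ) ^ b - 1 with hq_def
  have hs : 0 < a ^ 2 * ((n : ℝ) / d) := by positivity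
  have hX := mul_normSq_le_of_unit fun w hw => hsmin.2 ⟨w, hw, rfl⟩
  have hentry : ∀ᵐ ω ∂μ, ∀ i j, (X - Xt ω) i j ^ 2 ≤ (2 * (1 / Real.sqrt d) / q) ^ 2 := by
    rw [ae_all_iff]
    intro i
    rw [ae_all_iff]
    intro j
    obtain ⟨m, -, hXm, hae, -⟩ := hquant i j
    filter_upwards [hae] with ω hω
    rw [Matrix.sub_apply]
    obtain ⟨h1, h2⟩ := hXm
    rcases hω with h | h <;> rw [h] <;> apply sq_le_sq' <;> linarith
  have hbound : ∀ᵐ ω ∂μ, 1 - (1 / (max d d : ℝ)) * frobSq (Uᵀ * Ut ω)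
      ≤ 20 / (q ^ 2 * a ^ 4) := by
    filter_upwards [hentry] with ω hω
    have hsin := (mul_card_sub_overlap_le hs hX hU hUspan (hUt ω) (hUtspan ω)).trans
      (frobSq_le_of_entry_sq_le hω)
    have hc : (2 * (1 / Real.sqrt d) / q) ^ 2 = 4 / (d * q ^ 2) := by
      rw [div_pow, mul_pow, div_pow, Real.sq_sqrt hd0.le]
      field_simp
      norm_num
    rw [hc] at hsin
    have hscaled : 1 - (1 / (max d d : ℝ)) * frobSq (Uᵀ * Ut ω)
        = (a ^ 2 * ((n : ℝ) / d) * (d - frobSq (Uᵀ * Ut ω))) / (a ^ 2 * n) := by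
      rw [max_self]
      field_simp
    rw [hscaled]
    calc (a ^ 2 * ((n : ℝ) / d) * (d - frobSq (Uᵀ * Ut ω))) / (a ^ 2 * n)
        ≤ (n * d * (4 / (d * q ^ 2))) / (a ^ 2 * n) := by gcongr
      _ = 4 * a ^ 2 / (q ^ 2 * a ^ 4) := by field_simp
      _ ≤ 20 / (q ^ 2 * a ^ 4) := by
          gcongr
          nlinarith
  by_cases hint : Integrable (fun ω => 1 - (1 / (max d d : ℝ)) * frobSq (Uᵀ * Ut ω)) μ
  · simpa using integral_mono_ae hint (integrable_const _) hbound
  · rw [integral_undef hint]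
    positivity

end
end

section
/- Let X ∈ ℝ^{n×d} have entries X_{ij} ∈ [−1/√d, 1/√d], and let X̃ = X + C be a b-bit unbiased stochastic uniform quantization of X, so that C is a random matrix with independent entries satisfying E[C_{ij}] = 0, Var(C_{ij}) ≤ δ_b²/d, and |C_{ij}| ≤ 2/(√d·(2^b − 1)), where δ_b := 1/(2^b − 1). Then for n ≥ max(33, d), E[‖XCᵀ + CXᵀ + CCᵀ‖_F²] ≤ 20·n²·δ_b²/d. -/
open MeasureTheory Matrix ProbabilityTheory

noncomputable section

section SecondMoment

variable {Ω ι κ : Type*} [MeasurableSpace Ω] {μ : Measure Ω}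

/-- Second moment of a linear combination of centred, pairwise independent variables. -/
theorem integral_sq_sum_const_mul_le [IsProbabilityMeasure μ] [Fintype κ] {Y : κ → Ω → ℝ}
    {a : κ → ℝ} {A s : ℝ}
    (hY : ∀ k, MemLp (Y k) 2 μ) (hind : Pairwise fun k l => IndepFun (Y k) (Y l) μ)
    (hmean : ∀ k, ∫ ω, Y k ω ∂μ = 0) (hvar : ∀ k, ∫ ω, Y k ω ^ 2 ∂μ ≤ s)
    (ha : ∀ k, a k ^ 2 ≤ A) (hA : 0 ≤ A) :
    ∫ ω, (∑ k, a k * Y k ω) ^ 2 ∂μ ≤ Fintype.card κ * (A * s) := by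
  have hZ : ∀ k, MemLp (fun ω => a k * Y k ω) 2 μ := fun k => (hY k).const_mul (a k)
  have hZmean : ∀ k, ∫ ω, a k * Y k ω ∂μ = 0 := fun k => by
    rw [integral_const_mul, hmean, mul_zero]
  have hsum : Var[∑ k, fun ω => a k * Y k ω; μ] = ∑ k, Var[fun ω => a k * Y k ω; μ] :=
    IndepFun.variance_sum (fun k _ => hZ k) fun k _ l _ hkl =>
      (hind hkl).comp (measurable_const_mul (a k)) (measurable_const_mul (a l))
  have hmeanSum : ∫ ω, (∑ k, fun ω => a k * Y k ω) ω ∂μ = 0 := by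
    simp only [Finset.sum_apply]
    rw [integral_finsetSum _ fun k _ => (hZ k).integrable one_le_two]
    exact Finset.sum_eq_zero fun k _ => hZmean k
  rw [variance_of_integral_eq_zero
    (memLp_finsetSum' _ fun k _ => hZ k).aestronglyMeasurable.aemeasurable hmeanSum] at hsum
  simp only [Finset.sum_apply] at hsum
  rw [hsum]
  calc ∑ k, Var[fun ω => a k * Y k ω; μ] ≤ ∑ _k : κ, A * s := by
        refine Finset.sum_le_sum fun k _ => ?_
        rw [variance_const_mul,
          variance_of_integral_eq_zero (hY k).aestronglyMeasurable.aemeasurable (hmean k)]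
        exact mul_le_mul (ha k) (hvar k) (integral_nonneg fun ω => sq_nonneg _) hA
    _ = Fintype.card κ * (A * s) := by simp

/-- Second moment of the inner product of two distinct rows of a matrix with centred
independent entries. -/
theorem integral_sq_sum_mul_rows_le [IsProbabilityMeasure μ] [Fintype κ] {C : Ω → Matrix ι κ ℝ}
    {v : ℝ} (hmeas : ∀ i j, Measurable fun ω => C ω i j)
    (hind : iIndepFun (fun (p : ι × κ) ω => C ω p.1 p.2) μ)
    (hC : ∀ i j, MemLp (fun ω => C ω i j) ⊤ μ)
    (hmean : ∀ i j, ∫ ω, C ω i j ∂μ = 0) (hvar : ∀ i j, ∫ ω, C ω i j ^ 2 ∂μ ≤ v)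
    {i j : ι} (hij : i ≠ j) :
    ∫ ω, (∑ k, C ω i k * C ω j k) ^ 2 ∂μ ≤ Fintype.card κ * v ^ 2 := by
  have hpair : ∀ k, IndepFun (fun ω => C ω i k) (fun ω => C ω j k) μ := fun k =>
    hind.indepFun (i := (i, k)) (j := (j, k)) (by simp [hij])
  have h := integral_sq_sum_const_mul_le (μ := μ) (Y := fun k ω => C ω i k * C ω j k)
    (a := fun _ => 1) (A := 1) (s := v ^ 2)
    (fun k => ((hC j k).mul' (r := ⊤) (hC i k)).mono_exponent le_top)
    (fun k l hkl => hind.indepFun_mul_mul (fun p => hmeas p.1 p.2) (i, k) (j, k) (i, l) (j, l)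
      (by simp [hkl]) (by simp [hkl]) (by simp [hkl]) (by simp [hkl]))
    (fun k => by
      rw [(hpair k).integral_fun_mul_eq_mul_integral (hC i k).1 (hC j k).1, hmean, zero_mul])
    (fun k => by
      have hsq := ((hpair k).comp (measurable_id.pow_const 2)
        (measurable_id.pow_const 2)).integral_fun_mul_eq_mul_integral
        ((hmeas i k).pow_const 2).aestronglyMeasurable
        ((hmeas j k).pow_const 2).aestronglyMeasurable
      simp only [Function.comp_apply, id] at hsq
      simp only [mul_pow]
      rw [hsq, sq v]
      exact mul_le_mul (hvar i k) (hvar j k) (integral_nonneg fun ω => sq_nonneg _)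
        ((integral_nonneg fun ω => sq_nonneg _).trans (hvar i k)))
    (fun _ => by norm_num) zero_le_one
  simpa using h

/-- Fourth moment of the Euclidean norm of a random vector with bounded coordinates. -/
theorem integral_sq_sum_sq_le [IsFiniteMeasure μ] [Fintype κ] {Y : κ → Ω → ℝ} {B v : ℝ}
    (hY : ∀ k, MemLp (Y k) ⊤ μ) (hbdd : ∀ᵐ ω ∂μ, ∀ k, Y k ω ^ 2 ≤ B) (hB : 0 ≤ B)
    (hvar : ∀ k, ∫ ω, Y k ω ^ 2 ∂μ ≤ v) :
    ∫ ω, (∑ k, Y k ω * Y k ω) ^ 2 ∂μ ≤ Fintype.card κ ^ 2 * (B * v) := by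
  have hint : ∀ k, Integrable (fun ω => Y k ω ^ 2) μ := fun k =>
    ((hY k).mono_exponent le_top).integrable_sq
  calc ∫ ω, (∑ k, Y k ω * Y k ω) ^ 2 ∂μ
      ≤ ∫ ω, Fintype.card κ * B * ∑ k, Y k ω ^ 2 ∂μ := by
        refine integral_mono_ae (MemLp.integrable_sq ?_)
          ((integrable_finsetSum _ fun k _ => hint k).const_mul _) ?_
        · exact memLp_finsetSum _ fun k _ =>
            ((hY k).mul' (r := ⊤) (hY k)).mono_exponent le_top
        · filter_upwards [hbdd] with ω hω
          have hle : ∑ k, Y k ω ^ 2 ≤ Fintype.card κ * B := by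
            simpa using Finset.sum_le_card_nsmul Finset.univ _ B fun k _ => hω k
          simp only [← sq]
          rw [sq (∑ k, Y k ω ^ 2)]
          exact mul_le_mul_of_nonneg_right hle (Finset.sum_nonneg fun k _ => sq_nonneg _)
    _ = Fintype.card κ * B * ∑ k, ∫ ω, Y k ω ^ 2 ∂μ := by
        rw [integral_const_mul, integral_finsetSum _ fun k _ => hint k]
    _ ≤ Fintype.card κ * B * (Fintype.card κ * v) := by
        gcongr
        simpa using Finset.sum_le_card_nsmul Finset.univ _ v fun k _ => hvar k
    _ = Fintype.card κ ^ 2 * (B * v) := by ring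

theorem integral_sq_add_add_le {f g h : Ω → ℝ} (hf : MemLp f 2 μ) (hg : MemLp g 2 μ)
    (hh : MemLp h 2 μ) :
    ∫ ω, (f ω + g ω + h ω) ^ 2 ∂μ
      ≤ 4 * ∫ ω, f ω ^ 2 ∂μ + 4 * ∫ ω, g ω ^ 2 ∂μ + 2 * ∫ ω, h ω ^ 2 ∂μ := by
  have hf' := hf.integrable_sq.const_mul 4
  have hg' := hg.integrable_sq.const_mul 4
  have hh' := hh.integrable_sq.const_mul 2
  simp only [← integral_const_mul]
  rw [← integral_add hf' hg', ← integral_add (by exact hf'.add hg') hh']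
  refine integral_mono ((hf.add hg).add hh).integrable_sq ((hf'.add hg').add hh') fun ω => ?_
  dsimp only [Pi.add_apply]
  nlinarith [sq_nonneg (f ω - g ω), sq_nonneg (f ω + g ω - h ω)]

end SecondMoment

/-- Let `X ∈ ℝ^{n×d}` have entries in `[−1/√d, 1/√d]`, and let
`X̃ = X + C` be a `b`-bit unbiased stochastic uniform quantization of `X`, so `C` has
independent entries with `E[C_{ij}] = 0`, `Var(C_{ij}) ≤ δ_b²/d`, and
`|C_{ij}| ≤ 2/(√d (2^b − 1))`, where `δ_b = 1/(2^b − 1)`.  Then for `n ≥ max(33, d)`,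
`E[‖XCᵀ + CXᵀ + CCᵀ‖_F²] ≤ 20 n² δ_b²/d`. -/
theorem expected_frobSq_perturbation_le
    {n d b : ℕ} {Ω : Type} [MeasurableSpace Ω]
    (μ : Measure Ω) [IsProbabilityMeasure μ]
    (X : Matrix (Fin n) (Fin d) ℝ) (C : Ω → Matrix (Fin n) (Fin d) ℝ)
    (δb : ℝ) (hδb : δb = 1 / ((2 : ℝ) ^ b - 1))
    (hb : 1 ≤ b) (hd : 0 < d) (hn : max 33 d ≤ n)
    (hXbdd : ∀ i j, X i j ∈ Set.Icc (-(1 / Real.sqrt d)) (1 / Real.sqrt d))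
    (hCmeas : ∀ i j, Measurable fun ω => C ω i j)
    (hCind : iIndepFun
      (fun (p : Fin n × Fin d) ω => C ω p.1 p.2) μ)
    (hCmean : ∀ i j, ∫ ω, C ω i j ∂μ = 0)
    (hCvar : ∀ i j, ∫ ω, (C ω i j) ^ 2 ∂μ ≤ δb ^ 2 / d)
    (hCbdd : ∀ᵐ ω ∂μ, ∀ i j, |C ω i j| ≤ 2 / (Real.sqrt d * ((2 : ℝ) ^ b - 1))) :
    ∫ ω, frobSq (X * (C ω)ᵀ + C ω * Xᵀ + C ω * (C ω)ᵀ) ∂μ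
      ≤ 20 * (n : ℝ) ^ 2 * δb ^ 2 / d := by
  have hd' : (0 : ℝ) < d := by exact_mod_cast hd
  have hD : (0 : ℝ) < Real.sqrt d := Real.sqrt_pos.2 hd'
  have hpow : (2 : ℝ) ≤ 2 ^ b := by simpa using pow_le_pow_right₀ (one_le_two : (1 : ℝ) ≤ 2) hb
  have hδ0 : 0 ≤ δb := by rw [hδb]; exact one_div_nonneg.2 (by linarith)
  have hδ1 : δb ≤ 1 := by
    rw [hδb, div_le_one (by linarith)]
    linarith
  have hδsq : δb ^ 2 ≤ 1 := pow_le_one₀ hδ0 hδ1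
  have hX : ∀ i j, X i j ^ 2 ≤ 1 / d := fun i j => by
    calc X i j ^ 2 ≤ (1 / Real.sqrt d) ^ 2 := sq_le_sq' (hXbdd i j).1 (hXbdd i j).2
      _ = 1 / d := by rw [div_pow, Real.sq_sqrt hd'.le, one_pow]
  have hCtop : ∀ i j, MemLp (fun ω => C ω i j) ⊤ μ := fun i j =>
    memLp_top_of_bound (hCmeas i j).aestronglyMeasurable _
      (by filter_upwards [hCbdd] with ω hω using hω i j)
  have hC2 : ∀ i j, MemLp (fun ω => C ω i j) 2 μ := fun i j => (hCtop i j).mono_exponent le_top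
  have hCsq : ∀ᵐ ω ∂μ, ∀ i j, C ω i j ^ 2 ≤ 4 * δb ^ 2 / d := by
    filter_upwards [hCbdd] with ω hω i j
    calc C ω i j ^ 2 ≤ (2 / (Real.sqrt d * ((2 : ℝ) ^ b - 1))) ^ 2 :=
          sq_le_sq' (abs_le.1 (hω i j)).1 (abs_le.1 (hω i j)).2
      _ = 4 * δb ^ 2 / d := by
          rw [hδb, div_pow, mul_pow, Real.sq_sqrt hd'.le, div_pow]
          field_simp
          norm_num
  have hlin : ∀ i j, ∫ ω, (∑ k, X i k * C ω j k) ^ 2 ∂μ ≤ δb ^ 2 / d := fun i j => by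
    have h := integral_sq_sum_const_mul_le (fun k => hC2 j k)
      (fun k l hkl => hCind.indepFun (i := (j, k)) (j := (j, l)) (by simp [hkl]))
      (hCmean j) (hCvar j) (hX i) (by positivity)
    rw [Fintype.card_fin] at h
    exact h.trans_eq (by field_simp)
  have hquad : ∀ i j, ∫ ω, (∑ k, C ω i k * C ω j k) ^ 2 ∂μ
      ≤ δb ^ 2 / d + if i = j then 4 * δb ^ 2 else 0 := fun i j => by
    split_ifs with hij
    · subst hij
      have h := integral_sq_sum_sq_le (fun k => hCtop i k)
        (by filter_upwards [hCsq] with ω hω using hω i) (by positivity) (hCvar i)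
      rw [Fintype.card_fin] at h
      have hpos : 0 ≤ δb ^ 2 / d := by positivity
      have heq : (d : ℝ) ^ 2 * (4 * δb ^ 2 / d * (δb ^ 2 / d)) = 4 * (δb ^ 2 * δb ^ 2) := by
        field_simp
      nlinarith [sq_nonneg δb]
    · have h := integral_sq_sum_mul_rows_le hCmeas hCind hCtop hCmean hCvar hij
      rw [Fintype.card_fin] at h
      have heq : (d : ℝ) * (δb ^ 2 / d) ^ 2 = δb ^ 2 * (δb ^ 2 / d) := by
        field_simp
      have hpos : 0 ≤ δb ^ 2 / d := by positivity
      nlinarith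
  have hlinMem : ∀ i j, MemLp (fun ω => ∑ k, X i k * C ω j k) 2 μ := fun i j =>
    memLp_finsetSum _ fun k _ => (hC2 j k).const_mul _
  have hquadMem : ∀ i j, MemLp (fun ω => ∑ k, C ω i k * C ω j k) 2 μ := fun i j =>
    memLp_finsetSum _ fun k _ => ((hCtop j k).mul' (r := ⊤) (hCtop i k)).mono_exponent le_top
  have hentry : ∀ ω i j, (X * (C ω)ᵀ + C ω * Xᵀ + C ω * (C ω)ᵀ) i j
      = ∑ k, X i k * C ω j k + ∑ k, X j k * C ω i k + ∑ k, C ω i k * C ω j k := fun ω i j => by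
    simp only [Matrix.add_apply, Matrix.mul_apply, Matrix.transpose_apply, mul_comm (X j _)]
  have hint : ∀ i j, Integrable (fun ω => (∑ k, X i k * C ω j k + ∑ k, X j k * C ω i k
      + ∑ k, C ω i k * C ω j k) ^ 2) μ := fun i j =>
    (((hlinMem i j).add (hlinMem j i)).add (hquadMem i j)).integrable_sq
  have hnd : (d : ℝ) ≤ n := by exact_mod_cast (le_max_right 33 d).trans hn
  simp only [frobSq, hentry]
  rw [integral_finsetSum _ fun i _ => integrable_finsetSum _ fun j _ => hint i j]
  calc ∑ i, ∫ ω, ∑ j, (∑ k, X i k * C ω j k + ∑ k, X j k * C ω i k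
          + ∑ k, C ω i k * C ω j k) ^ 2 ∂μ
      ≤ ∑ i : Fin n, ∑ j : Fin n, (10 * (δb ^ 2 / d) + if i = j then 8 * δb ^ 2 else 0) := by
        refine Finset.sum_le_sum fun i _ => ?_
        rw [integral_finsetSum _ fun j _ => hint i j]
        refine Finset.sum_le_sum fun j _ => ?_
        have h := integral_sq_add_add_le (hlinMem i j) (hlinMem j i) (hquadMem i j)
        have hq := hquad i j
        split_ifs at hq ⊢ <;> linarith [hlin i j, hlin j i]
    _ = 10 * (n ^ 2 * (δb ^ 2 / d)) + 8 * (n * δb ^ 2) := by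
        simp only [Finset.sum_add_distrib, Finset.sum_ite_eq, Finset.mem_univ, if_true,
          Finset.sum_const, Finset.card_univ, Fintype.card_fin, nsmul_eq_mul]
        ring
    _ ≤ 20 * (n : ℝ) ^ 2 * δb ^ 2 / d := by
        have hdiag : n * δb ^ 2 ≤ n ^ 2 * (δb ^ 2 / d) := by
          calc n * δb ^ 2 = n * d * (δb ^ 2 / d) := by field_simp
            _ ≤ n * n * (δb ^ 2 / d) := by gcongr
            _ = n ^ 2 * (δb ^ 2 / d) := by ring
        have hpos : 0 ≤ n ^ 2 * (δb ^ 2 / d) := by positivity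
        have heq : 20 * (n : ℝ) ^ 2 * δb ^ 2 / d = 20 * (n ^ 2 * (δb ^ 2 / d)) := by ring
        linarith

end
end

section
/- Let X ∈ ℝ^{n×d} have rows xᵢ with ‖xᵢ‖ ≤ 1, and let C ∈ ℝ^{n×d} be a random matrix with independent entries satisfying E[C_{ij}] = 0 and Var(C_{ij}) ≤ δ_b²/d, where δ_b := 1/(2^b − 1) ≤ 1. Then for every pair of distinct indices i ≠ j, writing H := XCᵀ + CXᵀ + CCᵀ, one has E[H_{ij}²] ≤ 3δ_b²/d. -/
open MeasureTheory Matrix ProbabilityTheory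

noncomputable section

namespace ProbabilityTheory

variable {Ω : Type*} [MeasurableSpace Ω] {μ : Measure Ω}

/-- If the sum of two independent real random variables is square integrable, so is the first. -/
lemma IndepFun.memLp_two_left_of_add [IsProbabilityMeasure μ] {f g : Ω → ℝ}
    (hfg : IndepFun f g μ)
    (hf : Measurable f) (hg : Measurable g) (h : MemLp (f + g) 2 μ) : MemLp f 2 μ := by
  have hsq : Integrable (fun ω => (f ω + g ω) ^ 2) μ := h.integrable_sq
  have hprod : Integrable (fun p : ℝ × ℝ => (p.1 + p.2) ^ 2) ((μ.map f).prod (μ.map g)) := by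
    rw [← hfg.map_prod_eq_prod_map_map hf.aemeasurable hg.aemeasurable,
      integrable_map_measure (by fun_prop) (by fun_prop)]
    exact hsq
  have := Measure.isProbabilityMeasure_map (μ := μ) hg.aemeasurable
  have := Measure.isProbabilityMeasure_map (μ := μ) hf.aemeasurable
  obtain ⟨y, hy⟩ := hprod.prod_left_ae.exists
  have hy' : Integrable (fun ω => (f ω + y) ^ 2) μ :=
    (integrable_map_measure (by fun_prop) (by fun_prop)).1 hy
  have hfy : MemLp (fun ω => f ω + y) 2 μ :=
    (memLp_two_iff_integrable_sq (by fun_prop)).2 hy'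
  simpa [Pi.sub_def] using hfy.sub (memLp_const y)

/-- If the product of two independent real random variables is square integrable and the second
one is not almost surely zero, then the first is square integrable. -/
lemma IndepFun.memLp_two_left_of_mul {f g : Ω → ℝ}
    (hfg : IndepFun f g μ)
    (hf : Measurable f) (hg : Measurable g) (h : MemLp (fun ω => f ω * g ω) 2 μ)
    (hg0 : ¬ g =ᵐ[μ] 0) : MemLp f 2 μ := by
  rw [memLp_two_iff_integrable_sq (by fun_prop)]
  have hsq : IndepFun (fun ω => f ω ^ 2) (fun ω => g ω ^ 2) μ :=
    hfg.comp (φ := fun x : ℝ => x ^ 2) (ψ := fun x : ℝ => x ^ 2) (by fun_prop) (by fun_prop)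
  refine hsq.integrable_left_of_integrable_op (fun x y => x * y) 1 one_ne_zero
    (fun x y => by simp) ?_ (by fun_prop) (by fun_prop) ?_
  · simpa only [mul_pow] using h.integrable_sq
  · refine fun h0 => hg0 ?_
    filter_upwards [h0] with ω hω
    simpa using hω

/-- The centred product of two independent real random variables `x + A` and `y + B` with
`E[A] = E[B] = 0` has mean zero and an explicit variance bound, as soon as it is square
integrable. -/
lemma IndepFun.integral_eq_zero_and_variance_le_of_shifted_mul [IsProbabilityMeasure μ]
    {A B : Ω → ℝ} (hAB : IndepFun A B μ)
    (hA : Measurable A) (hB : Measurable B) (hA0 : ∫ ω, A ω ∂μ = 0) (hB0 : ∫ ω, B ω ∂μ = 0)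
    {x y v : ℝ} (hAv : ∫ ω, A ω ^ 2 ∂μ ≤ v) (hBv : ∫ ω, B ω ^ 2 ∂μ ≤ v)
    (h : MemLp (fun ω => (x + A ω) * (y + B ω) - x * y) 2 μ) :
    ∫ ω, ((x + A ω) * (y + B ω) - x * y) ∂μ = 0 ∧
      variance (fun ω => (x + A ω) * (y + B ω) - x * y) μ ≤ (x ^ 2 + y ^ 2) * v + v ^ 2 := by
  have hv : 0 ≤ v := (integral_nonneg fun ω => sq_nonneg (A ω)).trans hAv
  have hmul : MemLp (fun ω => (x + A ω) * (y + B ω)) 2 μ := by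
    simpa [Pi.add_def] using h.add (memLp_const (x * y))
  have hind : IndepFun (fun ω => x + A ω) (fun ω => y + B ω) μ :=
    hAB.comp (φ := fun t : ℝ => x + t) (ψ := fun t : ℝ => y + t) (by fun_prop) (by fun_prop)
  have hshift : ∀ {D : Ω → ℝ} {z : ℝ}, ∫ ω, D ω ∂μ = 0 → (fun ω => z + D ω) =ᵐ[μ] 0 → z = 0 := by
    intro D z hD hz
    have hDz : D =ᵐ[μ] fun _ => -z := by
      filter_upwards [hz] with ω hω
      simp only [Pi.zero_apply] at hω
      linarith
    rw [integral_congr_ae hDz] at hD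
    simpa using hD
  have hzero : ∀ {T : Ω → ℝ}, T =ᵐ[μ] 0 → ∫ ω, T ω ∂μ = 0 ∧
      variance T μ ≤ (x ^ 2 + y ^ 2) * v + v ^ 2 := by
    intro T hT
    refine ⟨by rw [integral_congr_ae hT]; simp, ?_⟩
    rw [variance_congr hT, variance_zero]
    positivity
  by_cases hx : (fun ω => x + A ω) =ᵐ[μ] 0
  · refine hzero ?_
    filter_upwards [hx] with ω hω
    simp_all [hshift hA0 hx]
  by_cases hy : (fun ω => y + B ω) =ᵐ[μ] 0
  · refine hzero ?_
    filter_upwards [hy] with ω hω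
    simp_all [hshift hB0 hy]
  have hxA : MemLp (fun ω => x + A ω) 2 μ :=
    hind.memLp_two_left_of_mul (by fun_prop) (by fun_prop) hmul hy
  have hyB : MemLp (fun ω => y + B ω) 2 μ :=
    hind.symm.memLp_two_left_of_mul (by fun_prop) (by fun_prop)
      (by simpa only [mul_comm] using hmul) hx
  have hA2 : MemLp A 2 μ := by simpa [Pi.sub_def] using hxA.sub (memLp_const x)
  have hB2 : MemLp B 2 μ := by simpa [Pi.sub_def] using hyB.sub (memLp_const y)
  have hmean : ∀ {D : Ω → ℝ} (z : ℝ), MemLp D 2 μ → ∫ ω, D ω ∂μ = 0 →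
      ∫ ω, (z + D ω) ∂μ = z := by
    intro D z hD hD0
    rw [integral_add (integrable_const z) (hD.integrable one_le_two), hD0]
    simp
  have hmoment : ∀ {D : Ω → ℝ} (z : ℝ), MemLp D 2 μ → ∫ ω, D ω ∂μ = 0 →
      ∫ ω, (z + D ω) ^ 2 ∂μ = z ^ 2 + ∫ ω, D ω ^ 2 ∂μ := by
    intro D z hD hD0
    have hDi := hD.integrable one_le_two
    have heq : ∀ ω, (z + D ω) ^ 2 = (z ^ 2 + 2 * z * D ω) + D ω ^ 2 := fun ω => by ring
    simp_rw [heq]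
    rw [integral_add (by fun_prop) hD.integrable_sq,
      integral_add (integrable_const _) (hDi.const_mul _), integral_const_mul, hD0]
    simp
  have hprod : ∫ ω, (x + A ω) * (y + B ω) ∂μ = x * y := by
    rw [hind.integral_fun_mul_eq_mul_integral (by fun_prop) (by fun_prop), hmean x hA2 hA0,
      hmean y hB2 hB0]
  refine ⟨?_, ?_⟩
  · rw [integral_sub (hmul.integrable one_le_two) (integrable_const _), hprod]
    simp
  · have hsq : IndepFun (fun ω => (x + A ω) ^ 2) (fun ω => (y + B ω) ^ 2) μ :=
      hind.comp (φ := fun t : ℝ => t ^ 2) (ψ := fun t : ℝ => t ^ 2) (by fun_prop) (by fun_prop)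
    rw [variance_sub_const (by fun_prop), variance_eq_sub hmul, hprod]
    simp only [Pi.pow_apply, mul_pow]
    rw [hsq.integral_fun_mul_eq_mul_integral (by fun_prop) (by fun_prop), hmoment x hA2 hA0,
      hmoment y hB2 hB0]
    have ha : 0 ≤ ∫ ω, A ω ^ 2 ∂μ := integral_nonneg fun ω => sq_nonneg (A ω)
    have hb : 0 ≤ ∫ ω, B ω ^ 2 ∂μ := integral_nonneg fun ω => sq_nonneg (B ω)
    have h1 := mul_le_mul_of_nonneg_left hBv (sq_nonneg x)
    have h2 := mul_le_mul_of_nonneg_left hAv (sq_nonneg y)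
    have h3 := mul_le_mul hAv hBv hb hv
    nlinarith

/-- Functions of distinct columns of a random matrix with independent entries: one of them is
independent of the sum of the others. -/
lemma iIndepFun.indepFun_column_sum {m κ : Type*} [Fintype m]
    {Y : m × κ → Ω → ℝ} (hY : iIndepFun Y μ) (hYm : ∀ p, Measurable (Y p))
    (g : κ → (m → ℝ) → ℝ) (hg : ∀ k, Measurable (g k)) {k : κ} {s : Finset κ} (hk : k ∉ s) :
    IndepFun (fun ω => g k fun a => Y (a, k) ω)
      (∑ l ∈ s, fun ω => g l fun a => Y (a, l) ω) μ := by
  classical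
  have hdisj : Disjoint ((Finset.univ : Finset m) ×ˢ {k}) (Finset.univ ×ˢ s) := by
    rw [Finset.disjoint_left]
    rintro ⟨a, l⟩ h1 h2
    simp only [Finset.mem_product, Finset.mem_univ, Finset.mem_singleton, true_and] at h1 h2
    exact hk (h1 ▸ h2)
  have h := (hY.indepFun_finset _ _ hdisj hYm).comp
    (φ := fun f => g k fun a => f ⟨(a, k), by simp⟩)
    (ψ := fun f => ∑ l ∈ s.attach, g l fun a => f ⟨(a, l), by simp⟩)
    ((hg k).comp (measurable_pi_lambda _ fun _ => measurable_pi_apply _))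
    (Finset.measurable_fun_sum _ fun l _ =>
      (hg l).comp (measurable_pi_lambda _ fun _ => measurable_pi_apply _))
  convert! h using 1
  ext ω
  simp only [Finset.sum_apply, Function.comp_apply]
  exact (Finset.sum_attach s fun l => g l fun a => Y (a, l) ω).symm

end ProbabilityTheory

/-- Let `X ∈ ℝ^{n×d}` have rows of norm at most 1, and let `C` be a random
matrix with independent zero-mean entries with `Var(C_{ij}) ≤ δ_b²/d`, where
`δ_b = 1/(2^b − 1) ≤ 1`.  Then for all `i ≠ j`, writing `H = XCᵀ + CXᵀ + CCᵀ`,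
`E[H_{ij}²] ≤ 3 δ_b²/d`. -/
theorem expected_offdiag_entry_sq_le
    {n d b : ℕ} {Ω : Type} [MeasurableSpace Ω]
    (μ : Measure Ω) [IsProbabilityMeasure μ]
    (X : Matrix (Fin n) (Fin d) ℝ) (C : Ω → Matrix (Fin n) (Fin d) ℝ)
    (δb : ℝ) (hδb : δb = 1 / ((2 : ℝ) ^ b - 1)) (hδb1 : δb ≤ 1)
    (hd : 0 < d)
    (hXrow : ∀ i, ∑ j, (X i j) ^ 2 ≤ 1)
    (hCmeas : ∀ i j, Measurable fun ω => C ω i j)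
    (hCind : iIndepFun
      (fun (p : Fin n × Fin d) ω => C ω p.1 p.2) μ)
    (hCmean : ∀ i j, ∫ ω, C ω i j ∂μ = 0)
    (hCvar : ∀ i j, ∫ ω, (C ω i j) ^ 2 ∂μ ≤ δb ^ 2 / d) :
    ∀ i j : Fin n, i ≠ j →
      ∫ ω, ((X * (C ω)ᵀ + C ω * Xᵀ + C ω * (C ω)ᵀ) i j) ^ 2 ∂μ ≤ 3 * δb ^ 2 / d := by
  intro i j hij
  have hδ0 : 0 ≤ δb := by
    rw [hδb]
    exact one_div_nonneg.2 (sub_nonneg.2 (one_le_pow₀ one_le_two))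
  have hd' : (0 : ℝ) < d := by exact_mod_cast hd
  set T : Fin d → Ω → ℝ := fun k ω => (X i k + C ω i k) * (X j k + C ω j k) - X i k * X j k
    with hT
  have hTm : ∀ k, Measurable (T k) := fun k =>
    (((hCmeas i k).const_add _).mul ((hCmeas j k).const_add _)).sub_const _
  have hentry : ∀ ω, (X * (C ω)ᵀ + C ω * Xᵀ + C ω * (C ω)ᵀ) i j = (∑ k, T k) ω := by
    intro ω
    simp only [Matrix.add_apply, Matrix.mul_apply, Matrix.transpose_apply, Finset.sum_apply, hT,
      ← Finset.sum_add_distrib]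
    exact Finset.sum_congr rfl fun k _ => by ring
  simp_rw [hentry]
  have hSm : ∀ s : Finset (Fin d), Measurable (∑ k ∈ s, T k) := fun s => by
    simpa only [← Finset.sum_apply] using Finset.measurable_fun_sum s fun k _ => hTm k
  by_cases hint : Integrable (fun ω => ((∑ k, T k) ω) ^ 2) μ
  swap
  · rw [integral_undef hint]
    positivity
  have hSLp : MemLp (∑ k, T k) 2 μ :=
    (memLp_two_iff_integrable_sq (hSm _).aestronglyMeasurable).2 hint
  have hindep : ∀ (k : Fin d) (s : Finset (Fin d)), k ∉ s → IndepFun (T k) (∑ l ∈ s, T l) μ :=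
    fun k s hk => hCind.indepFun_column_sum (fun p => hCmeas p.1 p.2)
      (fun k c => (X i k + c i) * (X j k + c j) - X i k * X j k) (fun k => by fun_prop) hk
  have hTLp : ∀ k, MemLp (T k) 2 μ := fun k =>
    (hindep k (Finset.univ.erase k) (Finset.notMem_erase _ _)).memLp_two_left_of_add
      (hTm k) (hSm _) (by rwa [Finset.add_sum_erase _ _ (Finset.mem_univ k)])
  have hmom := fun k => IndepFun.integral_eq_zero_and_variance_le_of_shifted_mul
    (hCind.indepFun (i := (i, k)) (j := (j, k)) (by simpa using hij))
    (hCmeas i k) (hCmeas j k) (hCmean i k) (hCmean j k) (hCvar i k) (hCvar j k) (hTLp k)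
  have hS0 : ∫ ω, (∑ k, T k) ω ∂μ = 0 := by
    simp only [Finset.sum_apply]
    rw [integral_finsetSum _ fun k _ => (hTLp k).integrable one_le_two]
    exact Finset.sum_eq_zero fun k _ => (hmom k).1
  rw [← variance_of_integral_eq_zero (hSm _).aemeasurable hS0,
    IndepFun.variance_sum (fun k _ => hTLp k) fun k _ l _ hkl => by
      simpa using hindep k {l} (by simpa using hkl)]
  calc ∑ k, variance (T k) μ
      ≤ ∑ k, ((X i k ^ 2 + X j k ^ 2) * (δb ^ 2 / d) + (δb ^ 2 / d) ^ 2) :=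
        Finset.sum_le_sum fun k _ => (hmom k).2
    _ = (∑ k, X i k ^ 2 + ∑ k, X j k ^ 2) * (δb ^ 2 / d) + δb ^ 2 * (δb ^ 2 / d) := by
        rw [Finset.sum_add_distrib, ← Finset.sum_mul, Finset.sum_add_distrib]
        simp only [Finset.sum_const, Finset.card_univ, Fintype.card_fin, nsmul_eq_mul]
        field_simp
    _ ≤ (1 + 1) * (δb ^ 2 / d) + 1 * (δb ^ 2 / d) := by
        gcongr
        · exact hXrow i
        · exact hXrow j
        · exact pow_le_one₀ hδ0 hδb1
    _ = 3 * δb ^ 2 / d := by ring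

end
end

section
/- Let X ∈ ℝ^{n×d} have entries X_{ij} ∈ [−1/√d, 1/√d] (so each row xᵢ satisfies ‖xᵢ‖ ≤ 1), and let C ∈ ℝ^{n×d} be a random matrix with independent entries satisfying E[C_{ij}] = 0, Var(C_{ij}) ≤ δ_b²/d, and |C_{ij}| ≤ 2/(√d·(2^b − 1)), where δ_b := 1/(2^b − 1) ≤ 1. Then for every diagonal index i, writing H := XCᵀ + CXᵀ + CCᵀ, one has E[H_{ii}²] ≤ 36δ_b²/d + 16δ_b⁴. -/
open MeasureTheory Matrix ProbabilityTheory

noncomputable section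

/-- The second moment of a sum of independent square-integrable variables is at most the sum of
their second moments plus the square of the mean of the sum. -/
theorem integral_sum_sq_le_of_iIndepFun {Ω ι : Type*} [Fintype ι] [MeasurableSpace Ω]
    {μ : Measure Ω} [IsProbabilityMeasure μ] {Z : ι → Ω → ℝ} (hZ : ∀ j, MemLp (Z j) 2 μ)
    (hind : iIndepFun Z μ) :
    ∫ ω, (∑ j, Z j ω) ^ 2 ∂μ ≤ ∑ j, ∫ ω, Z j ω ^ 2 ∂μ + (∑ j, ∫ ω, Z j ω ∂μ) ^ 2 := by
  have hsum : MemLp (∑ j, Z j) 2 μ := memLp_finsetSum' _ fun j _ => hZ j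
  have hvar : variance (∑ j, Z j) μ = ∑ j, variance (Z j) μ :=
    IndepFun.variance_sum (fun j _ => hZ j) fun _ _ _ _ hjk => hind.indepFun hjk
  have hle : ∑ j, variance (Z j) μ ≤ ∑ j, ∫ ω, Z j ω ^ 2 ∂μ :=
    Finset.sum_le_sum fun j _ => variance_le_expectation_sq (hZ j).1
  have hsub := variance_eq_sub hsum
  have hmean : ∫ ω, (∑ j, Z j) ω ∂μ = ∑ j, ∫ ω, Z j ω ∂μ := by
    simp only [Finset.sum_apply]
    exact integral_finsetSum _ fun j _ => (hZ j).integrable one_le_two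
  rw [hmean] at hsub
  simp only [Pi.pow_apply, Finset.sum_apply] at hsub
  linarith

/-- Let `X ∈ ℝ^{n×d}` have entries in `[−1/√d, 1/√d]` (so each row has norm
at most 1), and let `C` be a random matrix with independent zero-mean entries with
`Var(C_{ij}) ≤ δ_b²/d` and `|C_{ij}| ≤ 2/(√d (2^b − 1))`, where `δ_b = 1/(2^b − 1) ≤ 1`.
Then for every `i`, writing `H = XCᵀ + CXᵀ + CCᵀ`, `E[H_{ii}²] ≤ 36 δ_b²/d + 16 δ_b⁴`. -/
theorem expected_diag_entry_sq_le
    {n d b : ℕ} {Ω : Type} [MeasurableSpace Ω]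
    (μ : Measure Ω) [IsProbabilityMeasure μ]
    (X : Matrix (Fin n) (Fin d) ℝ) (C : Ω → Matrix (Fin n) (Fin d) ℝ)
    (δb : ℝ) (hδb : δb = 1 / ((2 : ℝ) ^ b - 1)) (hδb1 : δb ≤ 1)
    (hd : 0 < d)
    (hXbdd : ∀ i j, X i j ∈ Set.Icc (-(1 / Real.sqrt d)) (1 / Real.sqrt d))
    (hCmeas : ∀ i j, Measurable fun ω => C ω i j)
    (hCind : iIndepFun
      (fun (p : Fin n × Fin d) ω => C ω p.1 p.2) μ)
    (hCmean : ∀ i j, ∫ ω, C ω i j ∂μ = 0)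
    (hCvar : ∀ i j, ∫ ω, (C ω i j) ^ 2 ∂μ ≤ δb ^ 2 / d)
    (hCbdd : ∀ᵐ ω ∂μ, ∀ i j, |C ω i j| ≤ 2 / (Real.sqrt d * ((2 : ℝ) ^ b - 1))) :
    ∀ i : Fin n,
      ∫ ω, ((X * (C ω)ᵀ + C ω * Xᵀ + C ω * (C ω)ᵀ) i i) ^ 2 ∂μ
        ≤ 36 * δb ^ 2 / d + 16 * δb ^ 4 := by
  intro i
  have hd' : (0 : ℝ) < d := by exact_mod_cast hd
  have hs : 0 < Real.sqrt d := Real.sqrt_pos.2 hd'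
  have hδ0 : 0 ≤ δb := by
    rw [hδb]
    exact one_div_nonneg.2 (sub_nonneg.2 (one_le_pow₀ one_le_two))
  have hbound : 2 / (Real.sqrt d * ((2 : ℝ) ^ b - 1)) = 2 * δb / Real.sqrt d := by
    rw [hδb, ← div_div, mul_one_div, div_right_comm]
  rw [hbound] at hCbdd
  have hCle : ∀ᵐ ω ∂μ, ∀ j, |C ω i j| ≤ 2 / Real.sqrt d := by
    filter_upwards [hCbdd] with ω h j
    refine (h i j).trans ?_
    gcongr
    linarith
  have hCmem : ∀ j, MemLp (fun ω => C ω i j) ⊤ μ := fun j =>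
    memLp_top_of_bound (hCmeas i j).aestronglyMeasurable (2 / Real.sqrt d)
      (by filter_upwards [hCle] with ω h using h j)
  have hsq_mem : ∀ j, MemLp (fun ω => C ω i j ^ 2) ⊤ μ := fun j => by
    simpa only [pow_two] using (hCmem j).mul' (hCmem j)
  have hCint : ∀ j, Integrable (fun ω => C ω i j) μ := fun j => (hCmem j).integrable le_top
  have hsq_int : ∀ j, Integrable (fun ω => C ω i j ^ 2) μ := fun j =>
    (hsq_mem j).integrable le_top
  let Z : Fin d → Ω → ℝ := fun j ω => 2 * X i j * C ω i j + C ω i j ^ 2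
  have hZmem : ∀ j, MemLp (Z j) 2 μ := fun j =>
    (((hCmem j).const_mul (2 * X i j)).add (hsq_mem j)).mono_exponent le_top
  have hZind : iIndepFun Z μ :=
    (hCind.precomp (g := fun j : Fin d => (i, j)) (Prod.mk_right_injective i)).comp
      (fun j x => 2 * X i j * x + x ^ 2) fun j => by fun_prop
  have hZmean : ∀ j, ∫ ω, Z j ω ∂μ = ∫ ω, C ω i j ^ 2 ∂μ := fun j => by
    simp only [Z]
    rw [integral_add ((hCint j).const_mul _) (hsq_int j), integral_const_mul, hCmean]
    simp
  have hZsq : ∀ j, ∫ ω, Z j ω ^ 2 ∂μ ≤ 16 / d * (δb ^ 2 / d) := fun j => by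
    calc ∫ ω, Z j ω ^ 2 ∂μ ≤ ∫ ω, 16 / d * C ω i j ^ 2 ∂μ := by
          refine integral_mono_ae (hZmem j).integrable_sq ((hsq_int j).const_mul _) ?_
          filter_upwards [hCle] with ω h
          have hX : |X i j| ≤ 1 / Real.sqrt d := abs_le.2 (hXbdd i j)
          have hfac : |2 * X i j + C ω i j| ≤ 4 / Real.sqrt d := by
            calc |2 * X i j + C ω i j| ≤ |2 * X i j| + |C ω i j| := abs_add_le _ _
              _ ≤ 2 * (1 / Real.sqrt d) + 2 / Real.sqrt d := by
                rw [abs_mul, abs_two]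
                gcongr
                exact h j
              _ = 4 / Real.sqrt d := by ring
          have hfac_sq : (2 * X i j + C ω i j) ^ 2 ≤ 16 / d := by
            calc (2 * X i j + C ω i j) ^ 2 ≤ (4 / Real.sqrt d) ^ 2 :=
                  sq_le_sq.2 (hfac.trans (le_abs_self _))
              _ = 16 / d := by
                rw [div_pow, Real.sq_sqrt hd'.le]
                norm_num
          calc Z j ω ^ 2 = (2 * X i j + C ω i j) ^ 2 * C ω i j ^ 2 := by
                simp only [Z]
                ring
            _ ≤ 16 / d * C ω i j ^ 2 := by gcongr
      _ ≤ 16 / d * (δb ^ 2 / d) := by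
          rw [integral_const_mul]
          gcongr
          exact hCvar i j
  have hH : ∀ ω, (X * (C ω)ᵀ + C ω * Xᵀ + C ω * (C ω)ᵀ) i i = ∑ j, Z j ω := fun ω => by
    simp only [Matrix.add_apply, Matrix.mul_apply, Matrix.transpose_apply,
      ← Finset.sum_add_distrib, Z]
    exact Finset.sum_congr rfl fun j _ => by ring
  have hsecond : ∑ j, ∫ ω, Z j ω ^ 2 ∂μ ≤ 16 * δb ^ 2 / d := by
    refine (Finset.sum_le_sum fun j _ => hZsq j).trans_eq ?_
    rw [Finset.sum_const, Finset.card_univ, Fintype.card_fin, nsmul_eq_mul]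
    field_simp
  have hmean_le : ∑ j, ∫ ω, Z j ω ∂μ ≤ δb ^ 2 := by
    refine (Finset.sum_le_sum fun j _ => (hZmean j).trans_le (hCvar i j)).trans_eq ?_
    rw [Finset.sum_const, Finset.card_univ, Fintype.card_fin, nsmul_eq_mul]
    field_simp
  have hmean_nonneg : 0 ≤ ∑ j, ∫ ω, Z j ω ∂μ :=
    Finset.sum_nonneg fun j _ => (hZmean j).symm ▸ integral_nonneg fun ω => sq_nonneg _
  simp only [hH]
  calc ∫ ω, (∑ j, Z j ω) ^ 2 ∂μ
      ≤ ∑ j, ∫ ω, Z j ω ^ 2 ∂μ + (∑ j, ∫ ω, Z j ω ∂μ) ^ 2 :=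
        integral_sum_sq_le_of_iIndepFun hZmem hZind
    _ ≤ 16 * δb ^ 2 / d + (δb ^ 2) ^ 2 := by gcongr
    _ ≤ 36 * δb ^ 2 / d + 16 * δb ^ 4 := by
      rw [← pow_mul]
      gcongr
      · norm_num
      · exact le_mul_of_one_le_left (by positivity) (by norm_num)

end
end
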